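/- (Compositionality of WEB refinement.) Let M_C = ⟨S_C, →_C, L_C⟩, M_B = ⟨S_B, →_B, L_B⟩, and M_A = ⟨S_A, →_A, L_A⟩ be TSs with labels in a common set, and suppose the labeling functions L_B and L_A are injective. If M_C is a WEB refinement of M_B with respect to a refinement map r₁ : S_C → S_B, and M_B is a WEB refinement of M_A with respect to a refinement map r₂ : S_B → S_A, then M_C is a WEB refinement of M_A with respect to the composite refinement map r₂ ∘ r₁ : S_C → S_A. -/

import Mathlib

/-- A transition system: a transition relation and a labeling function. -/
structure TS (S : Type) (Λ : Type) where
  tr : S → S → Prop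
  L : S → Λ

/-- `B` is a well-founded equivalence bisimulation (WEB) on the TS `M`. -/
def isWEB {S Λ : Type} (M : TS S Λ) (B : S → S → Prop) : Prop :=
  Equivalence B ∧
  (∀ s w, B s w → M.L s = M.L w) ∧
  ∃ (W : Type) (prec : W → W → Prop), WellFounded prec ∧
    ∃ (rankt : S → W) (rankl : S → S → ℕ),
      ∀ s u w, B s w → M.tr s u →
        ((∃ v, M.tr w v ∧ B u v) ∨
         (B u w ∧ prec (rankt u) (rankt s)) ∨
         (∃ v, M.tr w v ∧ B s v ∧ rankl v s < rankl w s))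

/-- The disjoint-union TS of a concrete system `MC` and an abstract system `MA`,
with labeling given via the refinement map `r` on concrete states. -/
def duTS {SC SA Λ : Type} (MC : TS SC Λ) (MA : TS SA Λ) (r : SC → SA) :
    TS (SC ⊕ SA) Λ where
  tr x y :=
    match x, y with
    | Sum.inl s, Sum.inl u => MC.tr s u
    | Sum.inr s, Sum.inr u => MA.tr s u
    | _, _ => False
  L x :=
    match x with
    | Sum.inl s => MA.L (r s)
    | Sum.inr s => MA.L s

/-- `MC` is a WEB refinement of `MA` with respect to the refinement map `r`. -/
def WEBrefines {SC SA Λ : Type} (MC : TS SC Λ) (MA : TS SA Λ) (r : SC → SA) : Prop :=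
  ∃ B : (SC ⊕ SA) → (SC ⊕ SA) → Prop,
    (∀ s : SC, B (Sum.inl s) (Sum.inr (r s))) ∧ isWEB (duTS MC MA r) B

/-- `ρ`: map both components of the disjoint union into abstract states. -/
def rho {SC SA : Type} (r : SC → SA) : SC ⊕ SA → SA
  | Sum.inl s => r s
  | Sum.inr s => s

open Relation

/-- A transition of `M` that is invisible through `r`. -/
def Stutter {S T Λ : Type} (M : TS S Λ) (r : S → T) (s u : S) : Prop :=
  M.tr s u ∧ r u = r s

/-- Every visible transition of `MA` leaving `r w` is matched by a transition of `MC` from `w`. -/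
def MatchesExits {SC SA Λ : Type} (MC : TS SC Λ) (MA : TS SA Λ) (r : SC → SA) (w : SC) : Prop :=
  ∀ b, MA.tr (r w) b → b ≠ r w → ∃ v, MC.tr w v ∧ r v = b

/-- A description of WEB refinement by `r` without ranks, valid when the labeling of `MA` is
injective: see `WEBrefines.stutterRefines` and `StutterRefines.webRefines`. -/
structure StutterRefines {SC SA Λ : Type} (MC : TS SC Λ) (MA : TS SA Λ) (r : SC → SA) : Prop where
  exit : ∀ s u, MC.tr s u → r u ≠ r s → MA.tr (r s) (r u)
  reach : ∀ s, ∃ w, ReflTransGen (Stutter MC r) s w ∧ MatchesExits MC MA r w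
  diverge : ∀ s, MA.tr (r s) (r s) → ∃ u, Stutter MC r s u
  acc : ∀ s, ¬ MA.tr (r s) (r s) → Acc (fun x y => Stutter MC r y x) s

theorem Stutter.map_eq_of_reflTransGen {S T Λ : Type} {M : TS S Λ} {r : S → T} {s u : S}
    (h : ReflTransGen (Stutter M r) s u) : r u = r s := by
  induction h with
  | refl => rfl
  | tail _ h ih => exact h.2.trans ih

/-- `P` holds at the end of some `R`-path of length `n` from the given point. -/
def ReachesIn {α : Type*} (R : α → α → Prop) (P : α → Prop) : ℕ → α → Prop
  | 0 => P
  | n + 1 => fun s => ∃ v, R s v ∧ ReachesIn R P n v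

/-- A target that is always reachable admits a distance function. -/
theorem exists_rank_of_reflTransGen {α : Type*} {R : α → α → Prop} {P : α → Prop}
    (h : ∀ s, ∃ w, ReflTransGen R s w ∧ P w) :
    ∃ f : α → ℕ, ∀ s, P s ∨ ∃ v, R s v ∧ f v < f s := by
  classical
  have hD : ∀ s, ∃ n, ReachesIn R P n s := by
    intro s
    obtain ⟨w, hw, hP⟩ := h s
    induction hw using ReflTransGen.head_induction_on with
    | refl => exact ⟨0, hP⟩
    | head hab _ ih =>
      obtain ⟨n, hn⟩ := ih
      exact ⟨n + 1, _, hab, hn⟩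
  have hleast : ∀ s, ∃ n, ReachesIn R P n s ∧ ∀ m, ReachesIn R P m s → n ≤ m := fun s =>
    ⟨Nat.find (hD s), Nat.find_spec (hD s), fun _ hn => Nat.find_min' (hD s) hn⟩
  choose f hf hmin using hleast
  refine ⟨f, fun s => ?_⟩
  have hs := hf s
  rcases hn : f s with _ | n
  · rw [hn] at hs
    exact Or.inl hs
  · rw [hn] at hs
    obtain ⟨v, hv, hDv⟩ := hs
    exact Or.inr ⟨v, hv, Nat.lt_succ_of_le (hmin v n hDv)⟩

section

variable {SC SA Λ : Type} {MC : TS SC Λ} {MA : TS SA Λ} {r : SC → SA}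

theorem duTS_L (x : SC ⊕ SA) : (duTS MC MA r).L x = MA.L (rho r x) := by
  cases x <;> rfl

theorem WEBrefines.stutterRefines (hinj : Function.Injective MA.L) (h : WEBrefines MC MA r) :
    StutterRefines MC MA r := by
  obtain ⟨B, hB, heq, hL, W, prec, hwf, rankt, rankl, hstep⟩ := h
  have rho_eq : ∀ {x y}, B x y → rho r x = rho r y := fun {x y} hxy =>
    hinj (by simpa only [duTS_L] using hL x y hxy)
  have rel_of_eq : ∀ {s w}, r w = r s → B (Sum.inl w) (Sum.inr (r s)) := fun {s w} e =>
    e ▸ hB w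
  refine ⟨fun s u hsu hne => ?_, fun s => ?_, fun s hs => ?_, fun s hs => ?_⟩
  · rcases hstep (Sum.inl s) (Sum.inl u) _ (hB s) hsu with
      ⟨v | v, hv, huv⟩ | ⟨hu, -⟩ | ⟨v | v, hv, hsv, hlt⟩
    · exact hv.elim
    · obtain rfl : r u = v := rho_eq huv
      exact hv
    · exact absurd (rho_eq hu) hne
    · exact hv.elim
    · obtain rfl : r s = v := rho_eq hsv
      exact absurd hlt (lt_irrefl _)
  · suffices H : ∀ n w, r w = r s → rankl (Sum.inl w) (Sum.inr (r s)) = n →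
        ∃ w', ReflTransGen (Stutter MC r) w w' ∧ MatchesExits MC MA r w' from H _ s rfl rfl
    intro n
    induction n using Nat.strong_induction_on with
    | _ n ih =>
      intro w hw hn
      by_cases hdec : ∃ v, Stutter MC r w v ∧
          rankl (Sum.inl v) (Sum.inr (r s)) < rankl (Sum.inl w) (Sum.inr (r s))
      · obtain ⟨v, hv, hlt⟩ := hdec
        obtain ⟨w', hvw', hw'⟩ := ih _ (hn ▸ hlt) v (hv.2.trans hw) rfl
        exact ⟨w', hvw'.head hv, hw'⟩
      · refine ⟨w, .refl, fun b hb hne => ?_⟩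
        rw [hw] at hb hne
        rcases hstep (Sum.inr (r s)) (Sum.inr b) (Sum.inl w) (heq.symm (rel_of_eq hw)) hb with
          ⟨v | v, hv, hbv⟩ | ⟨hbw, -⟩ | ⟨v | v, hv, hsv, hlt⟩
        · exact ⟨v, hv, (rho_eq hbv).symm⟩
        · exact hv.elim
        · exact absurd ((rho_eq hbw).trans hw) hne
        · exact absurd ⟨v, ⟨hv, (rho_eq hsv).symm.trans hw.symm⟩, hlt⟩ hdec
        · exact hv.elim
  · rcases hstep (Sum.inr (r s)) (Sum.inr (r s)) (Sum.inl s) (heq.symm (hB s)) hs with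
      ⟨v | v, hv, hsv⟩ | ⟨-, hlt⟩ | ⟨v | v, hv, hsv, -⟩
    · exact ⟨v, hv, (rho_eq hsv).symm⟩
    · exact hv.elim
    · exact absurd hlt (hwf.irrefl.irrefl _)
    · exact ⟨v, hv, (rho_eq hsv).symm⟩
    · exact hv.elim
  · have hacc := (InvImage.wf (fun s : SC => rankt (Sum.inl s)) hwf).apply s
    induction hacc with
    | intro s _ ih =>
      refine ⟨s, fun u ⟨hsu, hr⟩ => ih u ?_ (by rwa [hr])⟩
      rcases hstep (Sum.inl s) (Sum.inl u) _ (hB s) hsu with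
        ⟨v | v, hv, huv⟩ | ⟨-, hlt⟩ | ⟨v | v, hv, hsv, hlt⟩
      · exact hv.elim
      · obtain rfl : r s = v := hr.symm.trans (rho_eq huv)
        exact absurd hv hs
      · exact hlt
      · exact hv.elim
      · obtain rfl : r s = v := rho_eq hsv
        exact absurd hlt (lt_irrefl _)

theorem StutterRefines.webRefines (h : StutterRefines MC MA r) : WEBrefines MC MA r := by
  obtain ⟨f, hf⟩ := exists_rank_of_reflTransGen h.reach
  refine ⟨fun x y => rho r x = rho r y, fun _ => rfl, ⟨fun _ => rfl, Eq.symm, Eq.trans⟩,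
    fun s w e => by simp only [duTS_L, e], SC ⊕ SA,
    fun x y => (duTS MC MA r).tr y x ∧ rho r x = rho r y ∧ ¬ MA.tr (rho r y) (rho r y), ⟨?_⟩,
    id, fun x _ => Sum.elim f (fun _ => 0) x, fun s u w hsw hsu => ?_⟩
  · rintro (s | a)
    · by_cases hs : MA.tr (r s) (r s)
      · exact ⟨_, fun _ hy => absurd hs hy.2.2⟩
      · have hacc := h.acc s hs
        induction hacc with
        | intro s _ ih =>
          refine ⟨_, ?_⟩
          rintro (u | b) ⟨hsu, hr, -⟩
          · exact ih u ⟨hsu, hr⟩ (by rwa [show r u = r s from hr])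
          · exact hsu.elim
    · refine ⟨_, ?_⟩
      rintro (u | b) ⟨hab, hr, hn⟩
      · exact hab.elim
      · obtain rfl : b = a := hr
        exact absurd hab hn
  · by_cases hu : rho r u = rho r s
    · by_cases hloop : MA.tr (rho r s) (rho r s)
      · left
        rw [hsw] at hloop hu
        rcases w with w | w
        · obtain ⟨v, hv, hr⟩ := h.diverge w hloop
          exact ⟨Sum.inl v, hv, hu.trans hr.symm⟩
        · exact ⟨Sum.inr w, hloop, hu⟩
      · exact Or.inr (Or.inl ⟨hu.trans hsw, hsu, hu, hloop⟩)
    · have hexit : MA.tr (rho r s) (rho r u) := by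
        rcases s with s | s <;> rcases u with u | u
        · exact h.exit s u hsu hu
        · exact hsu.elim
        · exact hsu.elim
        · exact hsu
      rw [hsw] at hexit hu
      rcases w with w | w
      · rcases hf w with hw | ⟨v, ⟨hv, hr⟩, hlt⟩
        · obtain ⟨v, hv, hr⟩ := hw _ hexit hu
          exact Or.inl ⟨Sum.inl v, hv, hr.symm⟩
        · exact Or.inr (Or.inr ⟨Sum.inl v, hv, hsw.trans hr.symm, hlt⟩)
      · exact Or.inl ⟨Sum.inr (rho r u), hexit, rfl⟩

end

section

variable {SC SB SA Λ : Type} {MC : TS SC Λ} {MB : TS SB Λ} {MA : TS SA Λ}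
  {r₁ : SC → SB} {r₂ : SB → SA}

theorem Stutter.comp {s u : SC} (h : Stutter MC r₁ s u) : Stutter MC (r₂ ∘ r₁) s u :=
  ⟨h.1, congrArg r₂ h.2⟩

/-- A stuttering path of `MB` lifts to one of `MC`. -/
theorem StutterRefines.lift_path (h₁ : StutterRefines MC MB r₁) {s : SC} {b : SB}
    (h : ReflTransGen (Stutter MB r₂) (r₁ s) b) :
    ∃ t, ReflTransGen (Stutter MC (r₂ ∘ r₁)) s t ∧ r₁ t = b := by
  induction h with
  | refl => exact ⟨s, .refl, rfl⟩
  | @tail b c _ hbc ih =>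
    obtain ⟨t, hst, rfl⟩ := ih
    by_cases hc : c = r₁ t
    · exact ⟨t, hst, hc.symm⟩
    · obtain ⟨w, htw, hw⟩ := h₁.reach t
      have hr := Stutter.map_eq_of_reflTransGen htw
      obtain ⟨v, hwv, rfl⟩ := hw c (hr ▸ hbc.1) (hr ▸ hc)
      refine ⟨v, (hst.trans (ReflTransGen.mono (fun _ _ => Stutter.comp) _ _ htw)).tail ⟨hwv, ?_⟩, rfl⟩
      exact hbc.2.trans (congrArg r₂ hr.symm)

theorem StutterRefines.comp (h₁ : StutterRefines MC MB r₁) (h₂ : StutterRefines MB MA r₂) :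
    StutterRefines MC MA (r₂ ∘ r₁) := by
  refine ⟨fun s u hsu hne => ?_, fun s => ?_, fun s hs => ?_, fun s hs => ?_⟩
  · exact h₂.exit _ _ (h₁.exit s u hsu fun e => hne (congrArg r₂ e)) hne
  · obtain ⟨b, hsb, hb⟩ := h₂.reach (r₁ s)
    obtain ⟨t, hst, rfl⟩ := h₁.lift_path hsb
    obtain ⟨w, htw, hw⟩ := h₁.reach t
    have hr := Stutter.map_eq_of_reflTransGen htw
    refine ⟨w, hst.trans (ReflTransGen.mono (fun _ _ => Stutter.comp) _ _ htw), fun c hc hne => ?_⟩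
    simp only [Function.comp_apply, hr] at hc hne
    obtain ⟨d, hd, rfl⟩ := hb c hc hne
    obtain ⟨v, hwv, rfl⟩ := hw d (hr ▸ hd) fun e => hne (by rw [e, hr])
    exact ⟨v, hwv, rfl⟩
  · obtain ⟨b, hb⟩ := h₂.diverge (r₁ s) hs
    by_cases hbs : b = r₁ s
    · subst hbs
      obtain ⟨u, hu⟩ := h₁.diverge s hb.1
      exact ⟨u, hu.comp⟩
    · obtain ⟨t, hst, rfl⟩ := h₁.lift_path (.single hb)
      rcases hst.cases_head with rfl | ⟨u, hu, -⟩
      · exact absurd rfl hbs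
      · exact ⟨u, hu⟩
  · have hacc := h₂.acc (r₁ s) hs
    generalize hb : r₁ s = b at hacc
    induction hacc generalizing s with
    | intro b hb' ih =>
      subst hb
      by_cases hloop : MB.tr (r₁ s) (r₁ s)
      · exact ih _ ⟨hloop, rfl⟩ s hs rfl
      have hacc₁ := h₁.acc s hloop
      induction hacc₁ with
      | intro s _ ih₁ =>
        refine ⟨s, fun u ⟨hsu, hr⟩ => ?_⟩
        have hu : ¬ MA.tr ((r₂ ∘ r₁) u) ((r₂ ∘ r₁) u) := by rwa [hr]
        by_cases e : r₁ u = r₁ s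
        · exact ih₁ u ⟨hsu, e⟩ hu (e ▸ hb') (e ▸ ih) (e ▸ hloop)
        · exact ih _ ⟨h₁.exit s u hsu e, hr⟩ u hu rfl

end

/-- compositionality of WEB refinement. -/
theorem stmt6 {SC SB SA Λ : Type} (MC : TS SC Λ) (MB : TS SB Λ) (MA : TS SA Λ)
    (hinjB : Function.Injective MB.L) (hinjA : Function.Injective MA.L)
    (r₁ : SC → SB) (r₂ : SB → SA)
    (h₁ : WEBrefines MC MB r₁) (h₂ : WEBrefines MB MA r₂) :
    WEBrefines MC MA (r₂ ∘ r₁) :=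
  ((h₁.stutterRefines hinjB).comp (h₂.stutterRefines hinjA)).webRefines
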